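/- Let n and d be positive integers with d < n, and let C ⊆ {0,1}^n be a codebook such that every pair of distinct codewords u, v ∈ C satisfies LCS(u, v) ≤ n − d − 1. Let x ∈ C be a codeword, let t be an integer with 0 ≤ t ≤ d, and let y be a subsequence of x of length n − t. Then for every codeword z ∈ C with z ≠ x, one has LCS(z, y) < LCS(x, y); in particular, x is the unique codeword of C maximizing LCS(·, y), so the decoder φ(y) = argmax_{u ∈ C} LCS(u, y) returns x. -/

import Mathlib

/-- Length of a longest common subsequence of two binary sequences. -/
def LCS (x y : List Bool) : ℕ :=
  ((x.sublists.filter (fun s => decide (s.Sublist y))).map List.length).foldr max 0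

theorem foldr_max_le_iff' (l : List ℕ) (k : ℕ) : l.foldr max 0 ≤ k ↔ ∀ a ∈ l, a ≤ k := by
  induction l with
  | nil => simp
  | cons a l ih => simp [ih]

theorem LCS_le_iff (x y : List Bool) (k : ℕ) :
    LCS x y ≤ k ↔ ∀ s : List Bool, s.Sublist x → s.Sublist y → s.length ≤ k := by
  unfold LCS
  rw [foldr_max_le_iff']
  simp only [List.mem_map, List.mem_filter, List.mem_sublists, decide_eq_true_eq]
  constructor
  · intro h s h1 h2
    exact h _ ⟨s, ⟨h1, h2⟩, rfl⟩
  · rintro h a ⟨s, ⟨h1, h2⟩, rfl⟩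
    exact h s h1 h2

/-- Decoder correctness: under the pairwise LCS constraint, the transmitted
codeword `x` strictly dominates every other codeword `z` in LCS score with the
received sequence `y`, so `x` is the unique argmax of `LCS (·, y)` over `C`. -/
theorem lcs_decoder_correct
    (n d : ℕ) (hn : 0 < n) (hd : 0 < d) (hdn : d < n)
    (C : Set (List Bool)) (hC : ∀ c ∈ C, c.length = n)
    (hpair : ∀ u ∈ C, ∀ v ∈ C, u ≠ v → LCS u v ≤ n - d - 1)
    (x : List Bool) (hx : x ∈ C)
    (t : ℕ) (ht : t ≤ d)
    (y : List Bool) (hy : y.Sublist x) (hylen : y.length = n - t) :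
    ∀ z ∈ C, z ≠ x → LCS z y < LCS x y := by
  intro z hz hne
  have h1 := (LCS_le_iff z x _).1 (hpair z hz x hx hne)
  have h2 : LCS z y ≤ n - d - 1 :=
    (LCS_le_iff z y _).2 fun s hs hs' => h1 s hs (hs'.trans hy)
  have h3 := (LCS_le_iff x y _).1 le_rfl y hy (List.Sublist.refl y)
  omega
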